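/- For every integer t ≥ 2 and every even integer ℓ ≥ 4, for all sufficiently large n there exists a plane graph G with n vertices such that the treewidth of G equals t, every bounded face of G has length at most ℓ, and the em-width of G satisfies emw(G) ≥ (ℓ/2 − 1)(t − 1). -/

import Mathlib

open Set Bornology

/-- A plane embedding of a simple graph: each vertex is mapped to a point of the
plane, each edge to an injective arc joining its endpoints; arcs avoid vertices
other than their endpoints and distinct arcs meet only at common endpoints. -/
structure PlaneEmbedding {V : Type} (G : SimpleGraph V) where
  pos : V → ℝ × ℝ
  pos_inj : Function.Injective pos
  arc : G.edgeSet → Set (ℝ × ℝ)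
  arc_path : ∀ e : G.edgeSet, ∃ u v : V, (e : Sym2 V) = s(u, v) ∧
    ∃ γ : Path (pos u) (pos v), Function.Injective ⇑γ ∧ Set.range ⇑γ = arc e
  arc_avoid : ∀ (e : G.edgeSet) (w : V), pos w ∈ arc e → w ∈ (e : Sym2 V)
  arc_inter : ∀ e f : G.edgeSet, e ≠ f → ∀ x ∈ arc e ∩ arc f,
    ∃ w : V, w ∈ (e : Sym2 V) ∧ w ∈ (f : Sym2 V) ∧ x = pos w

namespace PlaneEmbedding

variable {V : Type} {G : SimpleGraph V}

/-- The image (drawing) of the plane graph in the plane. -/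
def image (P : PlaneEmbedding G) : Set (ℝ × ℝ) :=
  Set.range P.pos ∪ ⋃ e : G.edgeSet, P.arc e

/-- A face: a connected component of the complement of the image. -/
def IsFace (P : PlaneEmbedding G) (f : Set (ℝ × ℝ)) : Prop :=
  ∃ x, x ∉ P.image ∧ f = connectedComponentIn (P.image)ᶜ x

def IsBoundedFace (P : PlaneEmbedding G) (f : Set (ℝ × ℝ)) : Prop :=
  P.IsFace f ∧ IsBounded f

def IsOuterFace (P : PlaneEmbedding G) (f : Set (ℝ × ℝ)) : Prop :=
  P.IsFace f ∧ ¬ IsBounded f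

/-- The vertices on the boundary of a face `f`. -/
def boundaryVerts (P : PlaneEmbedding G) (f : Set (ℝ × ℝ)) : Set V :=
  {v | P.pos v ∈ closure f}

/-- The weak dual: vertices are the bounded faces, two distinct faces being
adjacent when some edge lies on the boundary of both. -/
def weakDual (P : PlaneEmbedding G) :
    SimpleGraph {f : Set (ℝ × ℝ) // P.IsBoundedFace f} :=
  SimpleGraph.fromRel fun f g =>
    ∃ e : G.edgeSet, P.arc e ⊆ closure f.1 ∧ P.arc e ⊆ closure g.1

/-- `u⁺`: the bounded faces having `u` on their boundary. -/
def uPlus (P : PlaneEmbedding G) (u : V) :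
    Set {f : Set (ℝ × ℝ) // P.IsBoundedFace f} :=
  {f | u ∈ P.boundaryVerts f.1}

/-- The drawing of the subgraph induced by a set `S` of vertices. -/
def subImage (P : PlaneEmbedding G) (S : Set V) : Set (ℝ × ℝ) :=
  P.pos '' S ∪ ⋃ e ∈ {e : G.edgeSet | ∀ w, w ∈ (e : Sym2 V) → w ∈ S}, P.arc e

/-- The vertices of `S` lying on the boundary of the unbounded face of the
drawing of the subgraph induced by `S`. -/
def outerVerts (P : PlaneEmbedding G) (S : Set V) : Set V :=
  {v | v ∈ S ∧ ∃ x, x ∉ P.subImage S ∧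
    ¬ IsBounded (connectedComponentIn (P.subImage S)ᶜ x) ∧
    P.pos v ∈ closure (connectedComponentIn (P.subImage S)ᶜ x)}

/-- Remove the outer layer of vertices. -/
def peel (P : PlaneEmbedding G) (S : Set V) : Set V := S \ P.outerVerts S

/-- The embedding is (at most) `k`-outerplanar: `k` rounds of removing the
vertices on the outer boundary remove every vertex. -/
def OuterplanarAtMost (P : PlaneEmbedding G) (k : ℕ) : Prop :=
  (P.peel)^[k] Set.univ = ∅

/-- The drawing of the subgraph of all edges incident to vertices of `R`. -/
def familyImage (P : PlaneEmbedding G) (R : Set V) : Set (ℝ × ℝ) :=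
  ⋃ e ∈ {e : G.edgeSet | ∃ v ∈ R, v ∈ (e : Sym2 V)}, P.arc e

/-- `R` is nicely embedded: no bounded face of the subgraph of edges incident
to `R` strictly encloses a vertex of `G`. -/
def NicelyEmbedded (P : PlaneEmbedding G) (R : Set V) : Prop :=
  ∀ x, x ∉ P.familyImage R →
    IsBounded (connectedComponentIn (P.familyImage R)ᶜ x) →
    ∀ v : V, P.pos v ∉ connectedComponentIn (P.familyImage R)ᶜ x

/-- The facial completion: add a clique on the boundary of each bounded face. -/
def facialCompletion (P : PlaneEmbedding G) : SimpleGraph V :=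
  G ⊔ SimpleGraph.fromRel fun u v =>
    ∃ f, P.IsBoundedFace f ∧ u ∈ P.boundaryVerts f ∧ v ∈ P.boundaryVerts f

end PlaneEmbedding

/-- A tree together with a bag of vertices at each node. -/
structure Decomp (V : Type) : Type 1 where
  ι : Type
  tree : SimpleGraph ι
  isTree : tree.IsTree
  bag : ι → Set V

/-- `D` is a tree decomposition of `G`. -/
def IsTreeDecomp {V : Type} (G : SimpleGraph V) (D : Decomp V) : Prop :=
  (∀ v, ∃ i, v ∈ D.bag i) ∧
  (∀ u v, G.Adj u v → ∃ i, u ∈ D.bag i ∧ v ∈ D.bag i) ∧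
  (∀ v, (D.tree.induce {i | v ∈ D.bag i}).Connected)

/-- The treewidth of a graph. -/
noncomputable def treewidth {V : Type} (G : SimpleGraph V) : ℕ :=
  sInf {k | ∃ D : Decomp V, IsTreeDecomp G D ∧ ∀ i, (D.bag i).ncard ≤ k + 1}

/-- `D` is an embedded tree decomposition of the plane graph given by `P`. -/
def IsEmDecomp {V : Type} {G : SimpleGraph V} (P : PlaneEmbedding G)
    (D : Decomp V) : Prop :=
  IsTreeDecomp G D ∧ ∀ f, P.IsBoundedFace f → ∃ i, P.boundaryVerts f ⊆ D.bag i

/-- The em-width of a plane graph. -/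
noncomputable def emwidth {V : Type} {G : SimpleGraph V}
    (P : PlaneEmbedding G) : ℕ :=
  sInf {k | ∃ D : Decomp V, IsEmDecomp P D ∧ ∀ i, (D.bag i).ncard ≤ k + 1}

/-- A cut vertex: its removal disconnects two vertices that were connected. -/
def SimpleGraph.IsCutVertex {V : Type} (G : SimpleGraph V) (u : V) : Prop :=
  ∃ x y, ∃ (hx : x ≠ u) (hy : y ≠ u), G.Reachable x y ∧
    ¬ (G.induce {v | v ≠ u}).Reachable ⟨x, hx⟩ ⟨y, hy⟩

/-- An `r`-family: `r` vertices of degree 2 sharing the same two neighbors. -/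
def IsRFamily {V : Type} (G : SimpleGraph V) (R : Set V) (r : ℕ) : Prop :=
  R.ncard = r ∧ ∃ a b : V, a ≠ b ∧ ∀ v ∈ R, G.neighborSet v = {a, b}


/-- A set of vertices in which any two vertices are joined by a walk staying in the set. -/
def SimpleGraph.ConnectedWithin {V : Type} (G : SimpleGraph V) (A : Set V) : Prop :=
  ∀ x ∈ A, ∀ y ∈ A, ∃ p : G.Walk x y, ∀ z ∈ p.support, z ∈ A

/-- A set of vertices containing every path between two of its members. -/
def SimpleGraph.PathConvex {V : Type} (G : SimpleGraph V) (A : Set V) : Prop :=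
  ∀ x ∈ A, ∀ y ∈ A, ∀ p : G.Walk x y, p.IsPath → ∀ z ∈ p.support, z ∈ A

namespace SimpleGraph

variable {V : Type} {G : SimpleGraph V}

theorem PathConvex.inter {A B : Set V} (hA : G.PathConvex A) (hB : G.PathConvex B) :
    G.PathConvex (A ∩ B) := fun x hx y hy p hp z hz =>
  ⟨hA x hx.1 y hy.1 p hp z hz, hB x hx.2 y hy.2 p hp z hz⟩

theorem ConnectedWithin.pathConvex {A : Set V} (hG : G.IsAcyclic) (hA : G.ConnectedWithin A) :
    G.PathConvex A := by
  classical
  intro x hx y hy p hp z hz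
  obtain ⟨w, hw⟩ := hA x hx y hy
  have h : p = w.bypass :=
    congrArg Subtype.val ((hG.subsingleton_path x y).elim ⟨p, hp⟩ ⟨w.bypass, w.bypass_isPath⟩)
  subst h
  exact hw z (w.support_bypass_subset_support hz)

theorem ConnectedWithin.of_induce {A : Set V} (h : (G.induce A).Preconnected) :
    G.ConnectedWithin A := by
  intro x hx y hy
  obtain ⟨p⟩ := h ⟨x, hx⟩ ⟨y, hy⟩
  refine ⟨p.map (SimpleGraph.Embedding.induce A).toHom, fun z hz => ?_⟩
  have e := Walk.support_map (SimpleGraph.Embedding.induce A).toHom p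
  obtain ⟨a, -, rfl⟩ := List.mem_map.1 (Eq.mp (congrArg (z ∈ ·) e) hz)
  exact a.2

/-- The image of an initial segment under a sequence of successively adjacent vertices. -/
theorem ConnectedWithin.of_seq (f : ℕ → V) (N : ℕ)
    (hf : ∀ j, j + 1 < N → G.Adj (f j) (f (j + 1))) :
    G.ConnectedWithin (f '' {j | j < N}) := by
  have key : ∀ j, j < N → ∃ p : G.Walk (f 0) (f j), ∀ z ∈ p.support, z ∈ f '' {j | j < N} := by
    intro j
    induction j with
    | zero =>
      intro h
      exact ⟨Walk.nil, fun z hz => ⟨0, h, (List.mem_singleton.1 hz).symm⟩⟩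
    | succ j ih =>
      intro h
      obtain ⟨p, hp⟩ := ih (by omega)
      refine ⟨p.concat (hf j h), fun z hz => ?_⟩
      rw [Walk.support_concat, List.mem_append, List.mem_singleton] at hz
      rcases hz with hz | rfl
      · exact hp z hz
      · exact ⟨j + 1, h, rfl⟩
  rintro _ ⟨i, hi, rfl⟩ _ ⟨j, hj, rfl⟩
  obtain ⟨p, hp⟩ := key i hi
  obtain ⟨p', hp'⟩ := key j hj
  refine ⟨p.reverse.append p', fun z hz => ?_⟩
  rw [Walk.mem_support_append_iff, Walk.support_reverse, List.mem_reverse] at hz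
  exact hz.elim (hp z) (hp' z)

theorem ConnectedWithin.union {A B : Set V} (hA : G.ConnectedWithin A)
    (hB : G.ConnectedWithin B) (h : (A ∩ B).Nonempty) : G.ConnectedWithin (A ∪ B) := by
  obtain ⟨c, hcA, hcB⟩ := h
  have key : ∀ x ∈ A ∪ B, ∃ p : G.Walk c x, ∀ z ∈ p.support, z ∈ A ∪ B := by
    rintro x (hx | hx)
    · obtain ⟨p, hp⟩ := hA c hcA x hx
      exact ⟨p, fun z hz => Or.inl (hp z hz)⟩
    · obtain ⟨p, hp⟩ := hB c hcB x hx
      exact ⟨p, fun z hz => Or.inr (hp z hz)⟩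
  intro x hx y hy
  obtain ⟨p, hp⟩ := key x hx
  obtain ⟨p', hp'⟩ := key y hy
  refine ⟨p.reverse.append p', fun z hz => ?_⟩
  rw [Walk.mem_support_append_iff, Walk.support_reverse, List.mem_reverse] at hz
  exact hz.elim (hp z) (hp' z)

/-- The Helly property for three subtrees of a tree. -/
theorem IsTree.inter_inter_nonempty (hG : G.IsTree) {A B C : Set V}
    (hA : G.PathConvex A) (hB : G.PathConvex B) (hC : G.PathConvex C)
    (hAB : (A ∩ B).Nonempty) (hBC : (B ∩ C).Nonempty) (hAC : (A ∩ C).Nonempty) :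
    (A ∩ B ∩ C).Nonempty := by
  classical
  obtain ⟨x, hxA, hxB⟩ := hAB
  obtain ⟨y, hyB, hyC⟩ := hBC
  obtain ⟨z, hzA, hzC⟩ := hAC
  have key : ∀ {x z : V} (p : G.Walk x z), p.IsPath → x ∈ B → z ∈ C →
      ∃ u ∈ p.support, u ∈ B ∩ C := by
    intro x z p
    induction p with
    | nil => exact fun _ h1 h2 => ⟨_, by simp, h1, h2⟩
    | @cons x x' z hadj p ih =>
      intro hp hxB hzC
      rw [Walk.cons_isPath_iff] at hp
      by_cases hxC : x ∈ C
      · exact ⟨x, by simp, hxB, hxC⟩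
      obtain ⟨w, hw, -⟩ := hG.existsUnique_path z y
      have hq : ((p.append w).bypass.cons hadj).IsPath := by
        rw [Walk.cons_isPath_iff]
        refine ⟨Walk.bypass_isPath _, fun h => ?_⟩
        have h := Walk.support_bypass_subset_support _ h
        rw [Walk.mem_support_append_iff] at h
        rcases h with h | h
        · exact hp.2 h
        · exact hxC (hC z hzC y hyC w hw x h)
      obtain ⟨u, hu, hu'⟩ := ih hp.1 (hB x hxB y hyB _ hq x' (by simp)) hzC
      exact ⟨u, by simp [hu], hu'⟩
  obtain ⟨p, hp, -⟩ := hG.existsUnique_path x z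
  obtain ⟨u, hu, huB, huC⟩ := key p hp hxB hzC
  exact ⟨u, ⟨hA x hxA z hzA p hp u hu, huB⟩, huC⟩

/-- The Helly property for finitely many subtrees of a tree. -/
theorem IsTree.exists_mem_of_pairwise (hG : G.IsTree) {κ : Type} (s : Finset κ) (F : κ → Set V)
    (hF : ∀ a, G.PathConvex (F a)) (hinter : ∀ a b, (F a ∩ F b).Nonempty) (a₀ : κ) :
    ∃ i ∈ F a₀, ∀ a ∈ s, i ∈ F a := by
  classical
  induction s using Finset.induction_on generalizing F with
  | empty =>
    obtain ⟨i, hi, -⟩ := hinter a₀ a₀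
    exact ⟨i, hi, by simp⟩
  | insert a s _ ih =>
    obtain ⟨i, hi, his⟩ := ih (fun b => F b ∩ F a) (fun b => (hF b).inter (hF a)) (by
      intro b b'
      obtain ⟨i, ⟨h1, h2⟩, h3⟩ := hG.inter_inter_nonempty (hF b) (hF b') (hF a)
        (hinter b b') (hinter b' a) (hinter b a)
      exact ⟨i, ⟨h1, h3⟩, h2, h3⟩)
    refine ⟨i, hi.1, fun b hb => ?_⟩
    rcases Finset.mem_insert.1 hb with rfl | hb
    · exact hi.2
    · exact (his b hb).1

end SimpleGraph

theorem IsTreeDecomp.connectedWithin_hits {V : Type} {G : SimpleGraph V} {D : Decomp V}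
    (hD : IsTreeDecomp G D) {B : Set V} (hB : G.ConnectedWithin B) :
    D.tree.ConnectedWithin {i | (D.bag i ∩ B).Nonempty} := by
  have hv : ∀ v ∈ B, ∀ i j, v ∈ D.bag i → v ∈ D.bag j →
      ∃ p : D.tree.Walk i j, ∀ k ∈ p.support, (D.bag k ∩ B).Nonempty := by
    intro v hvB i j hi hj
    obtain ⟨p, hp⟩ := SimpleGraph.ConnectedWithin.of_induce (hD.2.2 v).preconnected i hi j hj
    exact ⟨p, fun k hk => ⟨v, hp k hk, hvB⟩⟩
  have key : ∀ {u v : V} (p : G.Walk u v), (∀ z ∈ p.support, z ∈ B) → ∀ i j,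
      u ∈ D.bag i → v ∈ D.bag j →
      ∃ p : D.tree.Walk i j, ∀ k ∈ p.support, (D.bag k ∩ B).Nonempty := by
    intro u v p
    induction p with
    | @nil u =>
      intro h i j hi hj
      exact hv u (h u (by simp)) i j hi hj
    | @cons u u' v hadj p ih =>
      intro h i j hi hj
      obtain ⟨k, hk, hk'⟩ := hD.2.1 _ _ hadj
      obtain ⟨p₁, hp₁⟩ := hv u (h u (by simp)) i k hi hk
      obtain ⟨p₂, hp₂⟩ := ih (fun z hz => h z (by simp [hz])) k j hk' hj
      refine ⟨p₁.append p₂, fun z hz => ?_⟩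
      rw [SimpleGraph.Walk.mem_support_append_iff] at hz
      exact hz.elim (hp₁ z) (hp₂ z)
  rintro i ⟨u, hui, huB⟩ j ⟨v, hvj, hvB⟩
  obtain ⟨p, hp⟩ := hB u huB v hvB
  exact key p hp i j hui hvj

/-- In a tree decomposition, some bag meets every element of a bramble. -/
theorem IsTreeDecomp.exists_bag_hits_bramble {V : Type} {G : SimpleGraph V} {D : Decomp V}
    (hD : IsTreeDecomp G D) {κ : Type} [Finite κ] [Nonempty κ] (B : κ → Set V)
    (hB : ∀ a, G.ConnectedWithin (B a))
    (htouch : ∀ a b, ∃ u ∈ B a, ∃ v ∈ B b, u = v ∨ G.Adj u v) :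
    ∃ i, ∀ a, (D.bag i ∩ B a).Nonempty := by
  have := Fintype.ofFinite κ
  obtain ⟨i, -, hi⟩ := D.isTree.exists_mem_of_pairwise Finset.univ
    (fun a => {i | (D.bag i ∩ B a).Nonempty})
    (fun a => (hD.connectedWithin_hits (hB a)).pathConvex D.isTree.isAcyclic)
    (by
      intro a b
      obtain ⟨u, hu, v, hv, rfl | h⟩ := htouch a b
      · obtain ⟨i, hi⟩ := hD.1 u
        exact ⟨i, ⟨u, hi, hu⟩, u, hi, hv⟩
      · obtain ⟨i, hi, hi'⟩ := hD.2.1 u v h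
        exact ⟨i, ⟨u, hi, hu⟩, v, hi', hv⟩)
    (Classical.arbitrary κ)
  exact ⟨i, fun a => hi a (Finset.mem_univ a)⟩

/-- The decomposition with a single bag containing every vertex. -/
def Decomp.trivial (V : Type) : Decomp V where
  ι := Unit
  tree := ⊥
  isTree := .of_subsingleton
  bag := fun _ => Set.univ

theorem isTreeDecomp_trivial {V : Type} (G : SimpleGraph V) : IsTreeDecomp G (Decomp.trivial V) := by
  refine ⟨fun v => ⟨(), Set.mem_univ v⟩, fun u v _ => ⟨(), Set.mem_univ u, Set.mem_univ v⟩,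
    fun v => ?_⟩
  refine (SimpleGraph.connected_iff _).2 ⟨fun a b => ?_, ⟨⟨(), Set.mem_univ v⟩⟩⟩
  have h : a = b := Subtype.ext (@Subsingleton.elim Unit _ a.1 b.1)
  exact h ▸ .refl _

theorem le_treewidth {V : Type} {G : SimpleGraph V} {k : ℕ}
    (h : ∀ D, IsTreeDecomp G D → ∃ i, k + 1 ≤ (D.bag i).ncard) : k ≤ treewidth G := by
  refine le_csInf ⟨(Set.univ : Set V).ncard, Decomp.trivial V, isTreeDecomp_trivial G,
    fun _ => Nat.le_succ _⟩ ?_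
  rintro j ⟨D, hD, hj⟩
  obtain ⟨i, hi⟩ := h D hD
  have := hj i
  omega

theorem le_emwidth {V : Type} {G : SimpleGraph V} {P : PlaneEmbedding G} {k : ℕ}
    (h : ∀ D, IsEmDecomp P D → ∃ i, k + 1 ≤ (D.bag i).ncard) : k ≤ emwidth P := by
  refine le_csInf ⟨(Set.univ : Set V).ncard, Decomp.trivial V,
    ⟨isTreeDecomp_trivial G, fun f _ => ⟨(), Set.subset_univ _⟩⟩, fun _ => Nat.le_succ _⟩ ?_
  rintro j ⟨D, hD, hj⟩
  obtain ⟨i, hi⟩ := h D hD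
  have := hj i
  omega

/-- The graph joining every vertex to its parent, where the vertices with parent `none` are joined
to an additional root. -/
def parentTree {V : Type} (par : V → Option V) : SimpleGraph (Option V) :=
  SimpleGraph.fromRel fun a b => ∃ v, a = some v ∧ b = par v

theorem parentTree_adj {V α : Type} [LinearOrder α] {r : V → α} {par : V → Option V}
    (hpar : ∀ v w, par v = some w → r v < r w) (v : V) :
    (parentTree par).Adj (some v) (par v) := by
  rw [parentTree, SimpleGraph.fromRel_adj]
  exact ⟨fun h => (hpar v v h.symm).false, Or.inl ⟨v, rfl, rfl⟩⟩

theorem isTree_parentTree {V α : Type} [Finite V] [LinearOrder α] {r : V → α}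
    {par : V → Option V} (hpar : ∀ v w, par v = some w → r v < r w) :
    (parentTree par).IsTree := by
  have hconn : (parentTree par).Connected := by
    have key : ∀ v, (parentTree par).Reachable (some v) none := by
      intro v
      induction v using (Finite.wellFounded_of_trans_of_irrefl (fun a b => r b < r a)).induction with
      | _ v ih =>
        have hadj := (parentTree_adj hpar v).reachable
        cases hp : par v with
        | none => rwa [hp] at hadj
        | some w => exact (hp ▸ hadj).trans (ih w (hpar v w hp))
    have key' : ∀ a, (parentTree par).Reachable a none
      | none => .refl _
      | some v => key v
    exact ⟨fun a b => (key' a).trans (key' b).symm⟩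
  rw [SimpleGraph.isTree_iff_connected_and_card]
  refine ⟨hconn, le_antisymm ?_ hconn.card_vert_le_card_edgeSet_add_one⟩
  rw [Finite.card_option, Nat.add_le_add_iff_right]
  refine Nat.card_le_card_of_surjective
    (fun v => ⟨s(some v, par v), parentTree_adj hpar v⟩ : V → (parentTree par).edgeSet) ?_
  rintro ⟨e, he⟩
  induction e using Sym2.ind with
  | _ a b =>
    rw [SimpleGraph.mem_edgeSet, parentTree, SimpleGraph.fromRel_adj] at he
    obtain ⟨-, ⟨v, rfl, rfl⟩ | ⟨v, rfl, rfl⟩⟩ := he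
    · exact ⟨v, rfl⟩
    · exact ⟨v, Subtype.ext Sym2.eq_swap⟩

/-- An elimination ordering in which every vertex has at most `k` later neighbours, pairwise
adjacent in the fill-in graph, bounds the treewidth by `k`. -/
theorem treewidth_le_of_elimination {V α : Type} [Finite V] [LinearOrder α] {G : SimpleGraph V}
    {k : ℕ} (r : V → α) (N : V → Set V)
    (hN : ∀ v, ∀ w ∈ N v, r v < r w)
    (hclique : ∀ v, ∀ u ∈ N v, ∀ w ∈ N v, u ≠ w → w ∈ N u ∨ u ∈ N w)
    (hG : ∀ u v, G.Adj u v → v ∈ N u ∨ u ∈ N v)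
    (hk : ∀ v, (N v).ncard ≤ k) : treewidth G ≤ k := by
  classical
  have hmin : ∀ v, ∃ o : Option V, (o = none → N v = ∅) ∧
      ∀ w, o = some w → w ∈ N v ∧ ∀ w' ∈ N v, r w ≤ r w' := by
    intro v
    rcases (N v).eq_empty_or_nonempty with h | h
    · exact ⟨none, fun _ => h, by simp⟩
    · obtain ⟨w, hw, hw'⟩ := Set.exists_min_image (N v) r (Set.toFinite _) h
      refine ⟨some w, by simp, ?_⟩
      rintro _ ⟨⟩
      exact ⟨hw, hw'⟩
  choose par hnone hsome using hmin
  have hpar : ∀ v w, par v = some w → r v < r w := fun v w h => hN v w (hsome v w h).1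
  let D : Decomp V :=
    { ι := Option V
      tree := parentTree par
      isTree := isTree_parentTree hpar
      bag := fun o => o.elim ∅ fun v => insert v (N v) }
  have hmem : ∀ v w, w ∈ D.bag (some v) ↔ w = v ∨ w ∈ N v := fun v w => Iff.rfl
  refine Nat.sInf_le ⟨D, ⟨fun v => ⟨some v, (hmem v v).2 (Or.inl rfl)⟩, ?_, ?_⟩, ?_⟩
  · intro u v huv
    rcases hG u v huv with h | h
    · exact ⟨some u, (hmem u u).2 (Or.inl rfl), (hmem u v).2 (Or.inr h)⟩
    · exact ⟨some v, (hmem v u).2 (Or.inr h), (hmem v v).2 (Or.inl rfl)⟩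
  · intro w
    have hw : some w ∈ {i | w ∈ D.bag i} := (hmem w w).2 (Or.inl rfl)
    have key : ∀ v (hv : some v ∈ {i | w ∈ D.bag i}),
        (D.tree.induce {i | w ∈ D.bag i}).Reachable ⟨some v, hv⟩ ⟨some w, hw⟩ := by
      intro v
      induction v using (Finite.wellFounded_of_trans_of_irrefl (fun a b => r b < r a)).induction with
      | _ v ih =>
        intro hv
        rcases (hmem v w).1 hv with rfl | hwv
        · exact .refl _
        · cases hp : par v with
          | none => exact absurd hwv (by simp [hnone v hp])
          | some u =>
            have hu := hsome v u hp
            have huw : some u ∈ {i | w ∈ D.bag i} := by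
              refine (hmem u w).2 ?_
              by_cases h : w = u
              · exact Or.inl h
              · rcases hclique v u hu.1 w hwv (Ne.symm h) with h' | h'
                · exact Or.inr h'
                · exact absurd (hN w u h') (not_lt.2 (hu.2 w hwv))
            refine SimpleGraph.Reachable.trans (SimpleGraph.Adj.reachable ?_)
              (ih u (hpar v u hp) huw)
            rw [SimpleGraph.comap_adj]
            have := parentTree_adj hpar v
            rwa [hp] at this
    have key' : ∀ i : {i | w ∈ D.bag i},
        (D.tree.induce {i | w ∈ D.bag i}).Reachable i ⟨some w, hw⟩
      | ⟨none, hi⟩ => absurd hi (Set.notMem_empty w)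
      | ⟨some v, hi⟩ => key v hi
    exact (SimpleGraph.connected_iff _).2
      ⟨fun a b => (key' a).trans (key' b).symm, ⟨⟨some w, hw⟩⟩⟩
  · rintro (_ | v)
    · exact (Set.ncard_empty V).trans_le (Nat.zero_le _)
    · exact (Set.ncard_insert_le v (N v)).trans (Nat.succ_le_succ (hk v))

/-- `w` is the upper neighbour of `z`, or its right neighbour on a row whose height is a multiple
of `p`. -/
def GridStep (p : ℤ) (z w : ℤ × ℤ) : Prop :=
  w = (z.1, z.2 + 1) ∨ p ∣ z.2 ∧ w = (z.1 + 1, z.2)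

/-- The graph on vertices with integer coordinates `c` given by the columns of the integer lattice
and those rows whose height is a multiple of `p`. -/
def gridGraph {V : Type} (p : ℤ) (c : V → ℤ × ℤ) : SimpleGraph V :=
  SimpleGraph.fromRel fun u v => GridStep p (c u) (c v)

/-- The lattice points of the square of side `H`, with a tail of length `r` below the origin. -/
def gridRegion (H r : ℤ) : Set (ℤ × ℤ) :=
  {z | 0 ≤ z.1 ∧ z.1 ≤ H ∧ z.2 ≤ H ∧ (0 ≤ z.2 ∨ z.1 = 0 ∧ -r ≤ z.2)}

theorem GridStep.ne {p : ℤ} {z w : ℤ × ℤ} (h : GridStep p z w) : z ≠ w := by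
  rintro rfl
  rcases h with h | ⟨-, h⟩
  · have := congrArg Prod.snd h
    simp at this
  · have := congrArg Prod.fst h
    simp at this

theorem GridStep.adj {V : Type} {p : ℤ} {c : V → ℤ × ℤ} {u v : V}
    (h : GridStep p (c u) (c v)) : (gridGraph p c).Adj u v :=
  (SimpleGraph.fromRel_adj _ _ _).2 ⟨fun e => h.ne (congrArg c e), Or.inl h⟩

theorem add_two_le_ncard {V : Type} {X : Set V} (hX : X.Finite) {k : ℕ} {g : Fin k → V}
    (hg : Function.Injective g) (hgX : ∀ i, g i ∈ X) {a b : V} (ha : a ∈ X) (hb : b ∈ X)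
    (hab : a ≠ b) (hag : ∀ i, g i ≠ a) (hbg : ∀ i, g i ≠ b) : k + 2 ≤ X.ncard := by
  have h1 : (Set.range g).ncard = k := by
    rw [← Nat.card_coe_set_eq, Nat.card_range_of_injective hg, Nat.card_fin]
  have hfin := Set.finite_range g
  have h2 : (insert b (Set.range g)).ncard = k + 1 := by
    rw [Set.ncard_insert_of_notMem _ hfin, h1]
    rintro ⟨i, hi⟩
    exact hbg i hi
  have h3 : (insert a (insert b (Set.range g))).ncard = k + 2 := by
    rw [Set.ncard_insert_of_notMem _ (hfin.insert b), h2]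
    rintro (h | ⟨i, hi⟩)
    · exact hab h
    · exact hag i hi
  rw [← h3]
  refine Set.ncard_le_ncard ?_ hX
  rintro x (rfl | rfl | ⟨i, rfl⟩)
  · exact ha
  · exact hb
  · exact hgX i

/-- A square grid with `k + 1` full rows has a bag with at least `k + 2` vertices in each of its
tree decompositions. -/
theorem exists_large_bag_gridGraph {V : Type} [Finite V] {c : V → ℤ × ℤ} {p k H : ℕ} {r : ℤ}
    (hc : ∀ z ∈ gridRegion H r, ∃ v, c v = z) (hp : 0 < p) (hk : 0 < k) (hH : H = p * k)
    {D : Decomp V} (hD : IsTreeDecomp (gridGraph p c) D) :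
    ∃ i, k + 2 ≤ (D.bag i).ncard := by
  have hkH : k ≤ H := by rw [hH]; exact Nat.le_mul_of_pos_left k hp
  have hd : ∀ x y : ℕ, ∃ v, x ≤ H → y ≤ H → c v = ((x : ℤ), (y : ℤ)) := by
    intro x y
    by_cases h : x ≤ H ∧ y ≤ H
    · obtain ⟨v, hv⟩ := hc ((x : ℤ), (y : ℤ)) (by simp [gridRegion, h.1, h.2])
      exact ⟨v, fun _ _ => hv⟩
    · obtain ⟨v, hv⟩ := hc (0, 0) (by simp [gridRegion])
      exact ⟨v, fun h1 h2 => absurd ⟨h1, h2⟩ h⟩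
  choose d hd using hd
  have hV : ∀ x y, x ≤ H → y + 1 ≤ H → (gridGraph p c).Adj (d x y) (d x (y + 1)) := by
    intro x y hx hy
    refine GridStep.adj (Or.inl ?_)
    rw [hd x y hx (by omega), hd x (y + 1) hx hy]
    simp
  have hR : ∀ x y, x + 1 ≤ H → y ≤ H → p ∣ y → (gridGraph p c).Adj (d x y) (d (x + 1) y) := by
    intro x y hx hy hpy
    refine GridStep.adj (Or.inr ?_)
    rw [hd x y (by omega) hy, hd (x + 1) y hx hy]
    exact ⟨Int.natCast_dvd_natCast.2 hpy, by simp⟩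
  have hrow : ∀ i, i < k → p * i < H := by
    intro i hi
    rw [hH]
    exact Nat.mul_lt_mul_of_pos_left hi hp
  let R : Fin k → Set V := fun i => (fun x => d x (p * i)) '' {x | x < k}
  let C : Fin k → Set V := fun j => (fun y => d j y) '' {y | y < H}
  let T : Set V := (fun x => d x H) '' {x | x < k}
  let E : Set V := (fun y => d k y) '' {y | y < H + 1}
  have hRmem : ∀ (i : Fin k) x, x < k → d x (p * i) ∈ R i := fun i x hx => ⟨x, hx, rfl⟩
  have hCmem : ∀ (j : Fin k) y, y < H → d j y ∈ C j := fun j y hy => ⟨y, hy, rfl⟩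
  have hTmem : ∀ x, x < k → d x H ∈ T := fun x hx => ⟨x, hx, rfl⟩
  have hEmem : ∀ y, y < H + 1 → d k y ∈ E := fun y hy => ⟨y, hy, rfl⟩
  have hRconn : ∀ i, (gridGraph p c).ConnectedWithin (R i) := fun i =>
    .of_seq _ k fun j hj => hR j _ (by omega) (hrow i i.2).le (dvd_mul_right _ _)
  have hCconn : ∀ j, (gridGraph p c).ConnectedWithin (C j) := fun j =>
    .of_seq _ H fun y hy => hV j y (by omega) (by omega)
  have hTconn : (gridGraph p c).ConnectedWithin T :=
    .of_seq _ k fun j hj => hR j H (by omega) le_rfl (hH ▸ dvd_mul_right _ _)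
  have hEconn : (gridGraph p c).ConnectedWithin E :=
    .of_seq _ (H + 1) fun y hy => hV k y hkH (by omega)
  let B : (Fin k × Fin k) ⊕ Bool → Set V :=
    Sum.elim (fun ij => R ij.1 ∪ C ij.2) (fun b => cond b T E)
  have hmeet : ∀ i j, (R i ∩ C j).Nonempty := fun i j =>
    ⟨d j (p * i), hRmem i j j.2, hCmem j (p * i) (hrow i i.2)⟩
  have hTC : ∀ j : Fin k, ∃ u ∈ C j, ∃ v ∈ T, (gridGraph p c).Adj u v := by
    intro j
    have h := hV j (H - 1) (by omega) (by omega)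
    rw [Nat.sub_add_cancel (by omega)] at h
    exact ⟨_, hCmem j (H - 1) (by omega), _, hTmem j j.2, h⟩
  have hER : ∀ i : Fin k, ∃ u ∈ R i, ∃ v ∈ E, (gridGraph p c).Adj u v := by
    intro i
    have h := hR (k - 1) (p * i) (by omega) (hrow i i.2).le (dvd_mul_right _ _)
    rw [Nat.sub_add_cancel (by omega)] at h
    exact ⟨_, hRmem i (k - 1) (by omega), _, hEmem _ (by have := hrow i i.2; omega), h⟩
  have hTE : ∃ u ∈ T, ∃ v ∈ E, (gridGraph p c).Adj u v := by
    have h := hR (k - 1) H (by omega) le_rfl (hH ▸ dvd_mul_right _ _)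
    rw [Nat.sub_add_cancel (by omega)] at h
    exact ⟨_, hTmem (k - 1) (by omega), _, hEmem H (by omega), h⟩
  have hself : ∀ a, (B a).Nonempty := by
    rintro (⟨i, j⟩ | _ | _)
    · exact ⟨_, Or.inl (hRmem i 0 hk)⟩
    · exact ⟨_, hEmem 0 (by omega)⟩
    · exact ⟨_, hTmem 0 hk⟩
  have htouch : ∀ a b, ∃ u ∈ B a, ∃ v ∈ B b, u = v ∨ (gridGraph p c).Adj u v := by
    rintro (⟨i, j⟩ | _ | _) (⟨i', j'⟩ | _ | _)
    · obtain ⟨u, hu, hu'⟩ := hmeet i j'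
      exact ⟨u, Or.inl hu, u, Or.inr hu', Or.inl rfl⟩
    · obtain ⟨u, hu, v, hv, h⟩ := hER i
      exact ⟨u, Or.inl hu, v, hv, Or.inr h⟩
    · obtain ⟨u, hu, v, hv, h⟩ := hTC j
      exact ⟨u, Or.inr hu, v, hv, Or.inr h⟩
    · obtain ⟨u, hu, v, hv, h⟩ := hER i'
      exact ⟨v, hv, u, Or.inl hu, Or.inr h.symm⟩
    · obtain ⟨u, hu⟩ := hself (Sum.inr false)
      exact ⟨u, hu, u, hu, Or.inl rfl⟩
    · obtain ⟨u, hu, v, hv, h⟩ := hTE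
      exact ⟨v, hv, u, hu, Or.inr h.symm⟩
    · obtain ⟨u, hu, v, hv, h⟩ := hTC j'
      exact ⟨v, hv, u, Or.inr hu, Or.inr h.symm⟩
    · obtain ⟨u, hu, v, hv, h⟩ := hTE
      exact ⟨u, hu, v, hv, Or.inr h⟩
    · obtain ⟨u, hu⟩ := hself (Sum.inr true)
      exact ⟨u, hu, u, hu, Or.inl rfl⟩
  have hconn : ∀ a, (gridGraph p c).ConnectedWithin (B a) := by
    rintro (⟨i, j⟩ | _ | _)
    · exact (hRconn i).union (hCconn j) (hmeet i j)
    · exact hEconn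
    · exact hTconn
  obtain ⟨b, hb⟩ := hD.exists_bag_hits_bramble B hconn htouch
  refine ⟨b, ?_⟩
  obtain ⟨t, htX, x, hx, rfl⟩ := hb (Sum.inr true)
  obtain ⟨e, heX, y, hy, rfl⟩ := hb (Sum.inr false)
  simp only [Set.mem_ofPred_eq] at hx hy
  have hct := hd x H (by omega) le_rfl
  have hce := hd k y hkH (by omega)
  have hne : d x H ≠ d k y := by
    intro h
    rw [h, hce, Prod.mk.injEq] at hct
    omega
  have hcross : (∀ i, (D.bag b ∩ R i).Nonempty) ∨ ∀ j, (D.bag b ∩ C j).Nonempty := by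
    by_contra! hcon
    obtain ⟨⟨i, hi⟩, j, hj⟩ := hcon
    obtain ⟨v, hv, hv' | hv'⟩ := hb (Sum.inl (i, j))
    · exact Set.notMem_empty v (hi ▸ ⟨hv, hv'⟩)
    · exact Set.notMem_empty v (hj ▸ ⟨hv, hv'⟩)
  rcases hcross with h | h
  · choose g hgX f hf hfg using h
    simp only [Set.mem_ofPred_eq] at hf hfg
    have hcg : ∀ i, c (g i) = ((f i : ℤ), ((p * i : ℕ) : ℤ)) := by
      intro i
      rw [← hfg i, hd (f i) (p * i) (by have := hf i; omega) (hrow i i.2).le]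
    refine add_two_le_ncard (Set.toFinite _) (g := g) ?_ hgX htX heX hne ?_ ?_
    · intro i j hij
      have h := hcg i
      rw [hij, hcg j, Prod.mk.injEq, Nat.cast_inj] at h
      exact Fin.ext (Nat.eq_of_mul_eq_mul_left hp (Nat.cast_injective h.2)).symm
    · intro i hi
      have h := hcg i
      rw [hi, hct, Prod.mk.injEq] at h
      have := hrow i i.2
      omega
    · intro i hi
      have h := hcg i
      rw [hi, hce, Prod.mk.injEq] at h
      have := hf i
      omega
  · choose g hgX f hf hfg using h
    simp only [Set.mem_ofPred_eq] at hf hfg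
    have hcg : ∀ i, c (g i) = ((i : ℤ), (f i : ℤ)) := by
      intro i
      rw [← hfg i, hd i (f i) (by omega) (hf i).le]
    refine add_two_le_ncard (Set.toFinite _) (g := g) ?_ hgX htX heX hne ?_ ?_
    · intro i j hij
      have h := hcg i
      rw [hij, hcg j, Prod.mk.injEq] at h
      exact Fin.ext (by omega)
    · intro i hi
      have h := hcg i
      rw [hi, hct, Prod.mk.injEq] at h
      have := hf i
      omega
    · intro i hi
      have h := hcg i
      rw [hi, hce, Prod.mk.injEq] at h
      omega

/-- The position of a lattice point in an elimination ordering of the grid: lexicographic, with the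
grid points of degree at most two in front. -/
noncomputable def gridRank (q : ℤ) (z : ℤ × ℤ) : ℕ ×ₗ ℤ ×ₗ ℤ :=
  open Classical in toLex (if 0 ≤ z.2 ∧ q ∣ z.2 then 1 else 0, toLex z)

/-- The later neighbours of a lattice point in the fill-in of the grid. -/
def gridFill (q H : ℤ) (z : ℤ × ℤ) : Set (ℤ × ℤ) :=
  {w | (z.2 < 0 ∧ w.1 = z.1 ∧ w.2 = z.2 + 1) ∨
    (0 ≤ z.2 ∧ ¬ q ∣ z.2 ∧ w.1 = z.1 ∧ (w.2 = z.2 + 1 ∨ w.2 = q * (z.2 / q))) ∨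
    (0 ≤ z.2 ∧ q ∣ z.2 ∧ q ∣ w.2 ∧ 0 ≤ w.2 ∧ w.2 ≤ H ∧
      (w.1 = z.1 ∧ z.2 < w.2 ∨ w.1 = z.1 + 1 ∧ w.2 ≤ z.2))}

theorem gridRank_lt {q : ℤ} {z w : ℤ × ℤ} :
    gridRank q z < gridRank q w ↔
      (¬ (0 ≤ z.2 ∧ q ∣ z.2) ∧ 0 ≤ w.2 ∧ q ∣ w.2) ∨
      ((0 ≤ z.2 ∧ q ∣ z.2 ↔ 0 ≤ w.2 ∧ q ∣ w.2) ∧ (z.1 < w.1 ∨ z.1 = w.1 ∧ z.2 < w.2)) := by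
  rw [gridRank, gridRank, Prod.Lex.toLex_lt_toLex, Prod.Lex.toLex_lt_toLex]
  by_cases h1 : 0 ≤ z.2 ∧ q ∣ z.2 <;> by_cases h2 : 0 ≤ w.2 ∧ q ∣ w.2 <;> simp [h1, h2]

theorem gridRank_lt_of_mem_gridFill {q H : ℤ} (hq : 0 < q) {z w : ℤ × ℤ}
    (h : w ∈ gridFill q H z) : gridRank q z < gridRank q w := by
  rw [gridRank_lt]
  have h1 := Int.mul_ediv_self_le (x := z.2) hq.ne'
  have h2 : 0 ≤ z.2 → 0 ≤ q * (z.2 / q) := fun h => mul_nonneg hq.le (Int.ediv_nonneg h hq.le)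
  have h3 : q ∣ q * (z.2 / q) := dvd_mul_right _ _
  rcases h with ⟨h, h', h''⟩ | ⟨h, h', h'', h4 | h4⟩ | ⟨h, h', h'', h4, h5, h6⟩
  · grind
  · grind
  · grind
  · grind

theorem Int.add_one_ediv_of_not_dvd {q y : ℤ} (hq : 0 < q) (h : ¬ q ∣ y + 1) :
    (y + 1) / q = y / q := by
  have h1 := Int.emod_add_mul_ediv y q
  have h2 := Int.emod_nonneg y hq.ne'
  have h3 := Int.emod_lt_of_pos y hq
  have h4 : y % q + 1 ≠ q := fun h4 => h ⟨y / q + 1, by rw [mul_add]; omega⟩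
  exact ((Int.ediv_emod_unique hq (r := y % q + 1)).2 ⟨by omega, by omega, by omega⟩).1

theorem gridFill_clique {q H : ℤ} (hq : 0 < q) {z u w : ℤ × ℤ} (hu : u ∈ gridFill q H z)
    (hw : w ∈ gridFill q H z) (huw : u ≠ w) (huH : u.2 ≤ H) (hwH : w.2 ≤ H) :
    w ∈ gridFill q H u ∨ u ∈ gridFill q H w := by
  have hsub : ∀ {u w : ℤ × ℤ}, u.2 ≤ H → 0 ≤ z.2 → ¬ q ∣ z.2 → u.1 = z.1 → w.1 = z.1 →
      u.2 = z.2 + 1 → w.2 = q * (z.2 / q) → w ∈ gridFill q H u ∨ u ∈ gridFill q H w := by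
    intro u w huH hz hqz hu1 hw1 hu2 hw2
    have h1 := Int.mul_ediv_self_le (x := z.2) hq.ne'
    have h2 : 0 ≤ q * (z.2 / q) := mul_nonneg hq.le (Int.ediv_nonneg hz hq.le)
    have h3 : q ∣ q * (z.2 / q) := dvd_mul_right _ _
    by_cases hqu : q ∣ u.2
    · exact Or.inr (Or.inr (Or.inr ⟨by omega, hw2 ▸ h3, hqu, by omega, huH,
        Or.inl ⟨by omega, by omega⟩⟩))
    · refine Or.inl (Or.inr (Or.inl ⟨by omega, hqu, by omega, Or.inr ?_⟩))
      rw [hw2, hu2, Int.add_one_ediv_of_not_dvd hq (hu2 ▸ hqu)]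
  rcases hu with ⟨h, h', h''⟩ | ⟨h, h', h'', h4⟩ | ⟨h, h', h'', h4, h5, h6⟩ <;>
  rcases hw with ⟨g, g', g''⟩ | ⟨g, g', g'', g4⟩ | ⟨g, g', g'', g4, g5, g6⟩
  all_goals try omega
  · exact absurd (Prod.ext (h'.trans g'.symm) (h''.trans g''.symm)) huw
  · rcases h4 with h4 | h4 <;> rcases g4 with g4 | g4
    · exact absurd (Prod.ext (h''.trans g''.symm) (h4.trans g4.symm)) huw
    · exact hsub huH h h' h'' g'' h4 g4
    · exact (hsub hwH h h' g'' h'' g4 h4).symm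
    · exact absurd (Prod.ext (h''.trans g''.symm) (h4.trans g4.symm)) huw
  · have hne : u.1 ≠ w.1 ∨ u.2 ≠ w.2 := by
      by_contra! hcon
      exact huw (Prod.ext hcon.1 hcon.2)
    have hcases : (w.1 = u.1 ∧ u.2 < w.2 ∨ w.1 = u.1 + 1 ∧ w.2 ≤ u.2) ∨
        (u.1 = w.1 ∧ w.2 < u.2 ∨ u.1 = w.1 + 1 ∧ u.2 ≤ w.2) := by omega
    rcases hcases with hcases | hcases
    · exact Or.inl (Or.inr (Or.inr ⟨h4, h'', g'', g4, g5, hcases⟩))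
    · exact Or.inr (Or.inr (Or.inr ⟨g4, g'', h'', h4, h5, hcases⟩))

theorem mem_gridFill_of_gridStep {q H r : ℤ} (hq : 0 < q) {z w : ℤ × ℤ}
    (hz : z ∈ gridRegion H r) (hw : w ∈ gridRegion H r) (h : GridStep q z w) :
    w ∈ gridFill q H z ∨ z ∈ gridFill q H w := by
  obtain ⟨x, y⟩ := z
  obtain ⟨x', y'⟩ := w
  simp only [gridRegion, Set.mem_ofPred_eq, GridStep, Prod.mk.injEq] at hz hw h
  rcases h with ⟨rfl, rfl⟩ | ⟨hqy, rfl, rfl⟩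
  · by_cases hy : y < 0
    · exact Or.inl (Or.inl ⟨hy, rfl, rfl⟩)
    by_cases hqy : q ∣ y
    · by_cases hqy' : q ∣ y + 1
      · exact Or.inl (Or.inr (Or.inr ⟨by omega, hqy, hqy', by simp only; omega, hw.2.2.1,
          Or.inl ⟨rfl, by simp⟩⟩))
      · refine Or.inr (Or.inr (Or.inl ⟨by simp only; omega, hqy', rfl, Or.inr ?_⟩))
        simp only
        rw [Int.add_one_ediv_of_not_dvd hq hqy', Int.mul_ediv_cancel' hqy]
    · exact Or.inl (Or.inr (Or.inl ⟨by simpa using hy, hqy, rfl, Or.inl rfl⟩))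
  · exact Or.inl (Or.inr (Or.inr ⟨by simp only; omega, hqy, hqy, by simp only; omega, hz.2.2.1,
      Or.inr ⟨rfl, le_rfl⟩⟩))

theorem ncard_gridFill_le {q : ℤ} {k : ℕ} (hq : 0 < q) (hk : 0 < k) (z : ℤ × ℤ) :
    (gridFill q (q * k) z).Finite ∧ (gridFill q (q * k) z).ncard ≤ k + 1 := by
  classical
  suffices h : ∃ F : Finset (ℤ × ℤ), gridFill q (q * k) z ⊆ F ∧ F.card ≤ k + 1 by
    obtain ⟨F, hF, hcard⟩ := h
    exact ⟨F.finite_toSet.subset hF, (Set.ncard_le_ncard hF F.finite_toSet).trans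
      ((Set.ncard_coe_finset F).trans_le hcard)⟩
  by_cases hz : z.2 < 0
  · refine ⟨{(z.1, z.2 + 1)}, ?_, by simp⟩
    rintro ⟨x, y⟩ (h | h | h)
    · simpa using h.2
    · omega
    · omega
  by_cases hqz : q ∣ z.2
  · refine ⟨(Finset.range (k + 1)).image fun i : ℕ =>
      (if z.2 < q * i then z.1 else z.1 + 1, q * (i : ℤ)), ?_,
      Finset.card_image_le.trans (Finset.card_range _).le⟩
    rintro ⟨x, y⟩ (h | h | ⟨-, -, ⟨a, ha⟩, h0, hH, h⟩)
    · omega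
    · exact absurd hqz h.2.1
    · simp only at ha h0 hH h
      subst ha
      have ha0 : 0 ≤ a := nonneg_of_mul_nonneg_right h0 hq
      have hak : a ≤ k := le_of_mul_le_mul_left hH hq
      lift a to ℕ using ha0
      refine Finset.mem_coe.2 (Finset.mem_image.2 ⟨a, Finset.mem_range.2 (by omega), ?_⟩)
      rcases h with h | h
      · simp [h.1, h.2]
      · simp [h.1, not_lt.2 h.2]
  · refine ⟨{(z.1, z.2 + 1), (z.1, q * (z.2 / q))}, ?_, Finset.card_le_two.trans (by omega)⟩
    rintro ⟨x, y⟩ (h | h | h)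
    · omega
    · rcases h with ⟨-, -, h1, h2 | h2⟩ <;> simp_all
    · exact absurd h.2.1 hqz

theorem treewidth_gridGraph_le {V : Type} [Finite V] {c : V → ℤ × ℤ} {q r : ℤ} {k : ℕ}
    (hinj : Function.Injective c) (hc : ∀ v, c v ∈ gridRegion (q * k) r) (hq : 0 < q)
    (hk : 0 < k) : treewidth (gridGraph q c) ≤ k + 1 := by
  refine treewidth_le_of_elimination (fun v => gridRank q (c v))
    (fun v => {w | c w ∈ gridFill q (q * k) (c v)})
    (fun v w hw => gridRank_lt_of_mem_gridFill hq hw)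
    (fun v u hu w hw huw => gridFill_clique hq hu hw (hinj.ne huw) (hc u).2.2.1 (hc w).2.2.1)
    ?_ ?_
  · intro u v huv
    rcases ((SimpleGraph.fromRel_adj _ _ _).1 huv).2 with h | h
    · exact mem_gridFill_of_gridStep hq (hc u) (hc v) h
    · exact (mem_gridFill_of_gridStep hq (hc v) (hc u) h).symm
  · intro v
    obtain ⟨hfin, hcard⟩ := ncard_gridFill_le hq hk (c v)
    exact (Set.ncard_le_ncard_of_injOn c (fun w hw => hw) hinj.injOn hfin).trans hcard

/-- A lattice point as a point of the plane. -/
def latticePoint (z : ℤ × ℤ) : ℝ × ℝ := (z.1, z.2)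

theorem latticePoint_injective : Function.Injective latticePoint := by
  rintro ⟨a, b⟩ ⟨a', b'⟩ h
  simpa [latticePoint] using h

theorem latticePoint_le {z w : ℤ × ℤ} : latticePoint z ≤ latticePoint w ↔ z ≤ w := by
  simp [latticePoint, Prod.le_def]

theorem GridStep.segment_eq {p : ℤ} {z w : ℤ × ℤ} (h : GridStep p z w) :
    segment ℝ (latticePoint z) (latticePoint w) = Set.Icc (latticePoint z) (latticePoint w) := by
  obtain ⟨x, y⟩ := z
  rcases h with rfl | ⟨-, rfl⟩
  · simp only [latticePoint]
    rw [← Prod.image_mk_segment_right, segment_eq_Icc (by simp), Set.Icc_prod_eq, Set.Icc_self,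
      Set.singleton_prod]
  · simp only [latticePoint]
    rw [← Prod.image_mk_segment_left, segment_eq_Icc (by simp), Set.Icc_prod_eq, Set.Icc_self,
      Set.prod_singleton]

theorem GridStep.eq_or_eq {p : ℤ} {z w n : ℤ × ℤ} (h : GridStep p z w)
    (hn : latticePoint n ∈ Set.Icc (latticePoint z) (latticePoint w)) : n = z ∨ n = w := by
  obtain ⟨⟨h1, h2⟩, h3, h4⟩ := And.intro (latticePoint_le.1 hn.1) (latticePoint_le.1 hn.2)
  obtain ⟨x, y⟩ := z
  obtain ⟨a, b⟩ := n
  rcases h with rfl | ⟨-, rfl⟩ <;> simp only [Prod.mk.injEq] at * <;> omega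

theorem GridStep.exists_latticePoint {p : ℤ} {z w z' w' : ℤ × ℤ} (h : GridStep p z w)
    (h' : GridStep p z' w') (hne : z ≠ z' ∨ w ≠ w') {P : ℝ × ℝ}
    (hP : P ∈ Set.Icc (latticePoint z) (latticePoint w))
    (hP' : P ∈ Set.Icc (latticePoint z') (latticePoint w')) : ∃ n, P = latticePoint n := by
  have hclose : ∀ {y y' : ℤ} {b : ℝ}, y ≠ y' → (y : ℝ) ≤ b → b ≤ y + 1 → (y' : ℝ) ≤ b →
      b ≤ y' + 1 → ∃ n : ℤ, b = n := by
    intro y y' b hne h1 h2 h3 h4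
    rcases lt_or_gt_of_ne hne with hlt | hlt
    · have : (y : ℝ) + 1 ≤ y' := by exact_mod_cast hlt
      exact ⟨y', by linarith⟩
    · have : (y' : ℝ) + 1 ≤ y := by exact_mod_cast hlt
      exact ⟨y, by linarith⟩
  obtain ⟨x, y⟩ := z
  obtain ⟨x', y'⟩ := z'
  obtain ⟨a, b⟩ := P
  obtain ⟨⟨h1, h2⟩, h3, h4⟩ := hP
  obtain ⟨⟨h1', h2'⟩, h3', h4'⟩ := hP'
  suffices (∃ n : ℤ, a = n) ∧ ∃ n : ℤ, b = n by
    obtain ⟨⟨n, rfl⟩, m, rfl⟩ := this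
    exact ⟨(n, m), rfl⟩
  rcases h with rfl | ⟨-, rfl⟩ <;> rcases h' with rfl | ⟨-, rfl⟩ <;>
    simp only [latticePoint, Int.cast_add, Int.cast_one] at *
  · have hx : x = x' := by exact_mod_cast (h1.antisymm h3).trans (h1'.antisymm h3').symm
    subst hx
    exact ⟨⟨x, h3.antisymm h1⟩, hclose (by rintro rfl; simp at hne) h2 h4 h2' h4'⟩
  · exact ⟨⟨x, h3.antisymm h1⟩, y', h4'.antisymm h2'⟩
  · exact ⟨⟨x', h3'.antisymm h1'⟩, y, h4.antisymm h2⟩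
  · have hy : y = y' := by exact_mod_cast (h2.antisymm h4).trans (h2'.antisymm h4').symm
    subst hy
    exact ⟨hclose (by rintro rfl; simp at hne) h1 h3 h1' h3', y, h4.antisymm h2⟩

theorem gridGraph_exists_gridStep {V : Type} {p : ℤ} {c : V → ℤ × ℤ} {e : Sym2 V}
    (he : e ∈ (gridGraph p c).edgeSet) : ∃ u v, e = s(u, v) ∧ GridStep p (c u) (c v) := by
  induction e using Sym2.ind with
  | _ a b =>
    rcases ((SimpleGraph.fromRel_adj _ _ _).1 ((SimpleGraph.mem_edgeSet _).1 he)).2 with h | h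
    · exact ⟨a, b, rfl, h⟩
    · exact ⟨b, a, Sym2.eq_swap, h⟩

theorem GridStep.asymm {p : ℤ} {z w : ℤ × ℤ} (h : GridStep p z w) : ¬ GridStep p w z := by
  obtain ⟨x, y⟩ := z
  obtain ⟨x', y'⟩ := w
  simp only [GridStep, Prod.mk.injEq] at *
  omega

/-- The straight-line drawing of a grid graph. -/
def gridEmbedding {V : Type} (p : ℤ) (c : V → ℤ × ℤ) (hc : Function.Injective c) :
    PlaneEmbedding (gridGraph p c) where
  pos v := latticePoint (c v)
  pos_inj := latticePoint_injective.comp hc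
  arc e := {P | ∃ u v, (e : Sym2 V) = s(u, v) ∧ GridStep p (c u) (c v) ∧
    P ∈ Set.Icc (latticePoint (c u)) (latticePoint (c v))}
  arc_path := by
    rintro ⟨e, he⟩
    obtain ⟨u, v, rfl, h⟩ := gridGraph_exists_gridStep he
    refine ⟨u, v, rfl, Path.segment _ _,
      Path.segment_injective_of_ne (latticePoint_injective.ne h.ne), ?_⟩
    rw [Path.range_segment, h.segment_eq]
    ext P
    refine ⟨fun hP => ⟨u, v, rfl, h, hP⟩, ?_⟩
    rintro ⟨u', v', huv, h', hP⟩
    rcases Sym2.eq_iff.1 huv with ⟨rfl, rfl⟩ | ⟨rfl, rfl⟩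
    · exact hP
    · exact absurd h' h.asymm
  arc_avoid := by
    rintro e w ⟨u, v, huv, h, hP⟩
    rw [huv, Sym2.mem_iff]
    exact (h.eq_or_eq hP).imp (fun h => hc h) fun h => hc h
  arc_inter := by
    rintro e f hef P ⟨⟨u, v, huv, h, hP⟩, u', v', huv', h', hP'⟩
    have hne : c u ≠ c u' ∨ c v ≠ c v' := by
      by_contra! hcon
      exact hef (Subtype.ext (by rw [huv, huv', hc hcon.1, hc hcon.2]))
    obtain ⟨n, rfl⟩ := h.exists_latticePoint h' hne hP hP'
    rw [huv, huv']
    have hn' := h'.eq_or_eq hP'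
    rcases h.eq_or_eq hP with rfl | rfl
    · exact ⟨u, Sym2.mem_mk_left u v, Sym2.mem_iff.2 (hn'.imp (fun h => hc h) fun h => hc h), rfl⟩
    · exact ⟨v, Sym2.mem_mk_right u v, Sym2.mem_iff.2 (hn'.imp (fun h => hc h) fun h => hc h), rfl⟩

theorem mem_image_gridEmbedding {V : Type} {p : ℤ} {c : V → ℤ × ℤ} {hc : Function.Injective c}
    {P : ℝ × ℝ} : P ∈ (gridEmbedding p c hc).image ↔ (∃ v, P = latticePoint (c v)) ∨
      ∃ u v, GridStep p (c u) (c v) ∧ P ∈ Set.Icc (latticePoint (c u)) (latticePoint (c v)) := by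
  constructor
  · rintro (⟨v, rfl⟩ | h)
    · exact Or.inl ⟨v, rfl⟩
    · obtain ⟨e, u, v, -, h⟩ := Set.mem_iUnion.1 h
      exact Or.inr ⟨u, v, h⟩
  · rintro (⟨v, rfl⟩ | ⟨u, v, h, hP⟩)
    · exact Or.inl ⟨v, rfl⟩
    · exact Or.inr (Set.mem_iUnion.2 ⟨⟨s(u, v), h.adj⟩, u, v, rfl, h, hP⟩)

/-- The union of the lines in the drawing of a square grid of side `q * k` with a tail. -/
def gridDrawing (q k r : ℤ) : Set (ℝ × ℝ) :=
  {P | (∃ x : ℤ, P.1 = x ∧ 0 ≤ x ∧ x ≤ q * k ∧ 0 ≤ P.2 ∧ P.2 ≤ q * k) ∨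
    (∃ j : ℤ, P.2 = q * j ∧ 0 ≤ j ∧ j ≤ k ∧ 0 ≤ P.1 ∧ P.1 ≤ q * k) ∨
    (P.1 = 0 ∧ -r ≤ P.2 ∧ P.2 ≤ 0)}

theorem image_gridEmbedding {V : Type} {q k r : ℤ} (hq : 0 < q) (hk : 0 < k) (hr : 0 ≤ r)
    {c : V → ℤ × ℤ} (hc : Function.Injective c)
    (hrange : ∀ z, (∃ v, c v = z) ↔ z ∈ gridRegion (q * k) r) :
    (gridEmbedding q c hc).image = gridDrawing q k r := by
  have hH : 0 < q * k := mul_pos hq hk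
  have hfloor : ∀ {b : ℝ} {a : ℤ}, b ≤ a → b = a ∨ ⌊b⌋ + 1 ≤ a := by
    intro b a h
    rcases h.eq_or_lt with h | h
    · exact Or.inl h
    · exact Or.inr (Int.floor_lt.2 h)
  have hstep : ∀ {z w : ℤ × ℤ} {P : ℝ × ℝ}, z ∈ gridRegion (q * k) r → w ∈ gridRegion (q * k) r →
      GridStep q z w → P ∈ Set.Icc (latticePoint z) (latticePoint w) →
      P ∈ (gridEmbedding q c hc).image := by
    intro z w P hz hw h hP
    obtain ⟨u, rfl⟩ := (hrange z).2 hz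
    obtain ⟨v, rfl⟩ := (hrange w).2 hw
    exact mem_image_gridEmbedding.2 (Or.inr ⟨u, v, h, hP⟩)
  have hpoint : ∀ {z : ℤ × ℤ}, z ∈ gridRegion (q * k) r →
      latticePoint z ∈ (gridEmbedding q c hc).image := by
    intro z hz
    obtain ⟨u, rfl⟩ := (hrange z).2 hz
    exact mem_image_gridEmbedding.2 (Or.inl ⟨u, rfl⟩)
  have hvert : ∀ {x : ℤ} {b : ℝ} {s t : ℤ}, s ≤ b → b ≤ t →
      (∀ y, s ≤ y → y ≤ t → (x, y) ∈ gridRegion (q * k) r) →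
      ((x : ℝ), b) ∈ (gridEmbedding q c hc).image := by
    intro x b s t hs ht h
    have hs' : s ≤ ⌊b⌋ := Int.le_floor.2 hs
    rcases hfloor ht with rfl | ht'
    · exact hpoint (z := (x, t)) (h t (by exact_mod_cast hs) le_rfl)
    · refine hstep (h ⌊b⌋ hs' (by omega)) (h (⌊b⌋ + 1) (by omega) ht') (Or.inl rfl) ⟨?_, ?_⟩
      · exact ⟨le_rfl, Int.floor_le b⟩
      · refine ⟨le_rfl, ?_⟩
        simpa [latticePoint] using (Int.lt_floor_add_one b).le
  ext ⟨a, b⟩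
  constructor
  · intro h
    rcases mem_image_gridEmbedding.1 h with ⟨v, hv⟩ | ⟨u, v, huv, ⟨h1, h2⟩, h3, h4⟩
    · obtain ⟨g1, g2, g3, g4⟩ := (hrange _).1 ⟨v, rfl⟩
      rw [hv]
      rcases g4 with g4 | ⟨g4, g5⟩
      · exact Or.inl ⟨_, rfl, g1, g2, by simpa [latticePoint] using g4,
          by simp only [latticePoint]; exact_mod_cast g3⟩
      · by_cases hy : 0 ≤ (c v).2
        · exact Or.inl ⟨_, rfl, g1, g2, by simpa [latticePoint] using hy,
            by simp only [latticePoint]; exact_mod_cast g3⟩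
        · exact Or.inr (Or.inr ⟨by simp [latticePoint, g4], by
            simp only [latticePoint]; exact_mod_cast g5, by
            simp only [latticePoint]; exact_mod_cast (not_le.1 hy).le⟩)
    · obtain ⟨g1, g2, g3, g4⟩ := (hrange _).1 ⟨u, rfl⟩
      obtain ⟨g1', g2', g3', g4'⟩ := (hrange _).1 ⟨v, rfl⟩
      generalize c u = z at *
      generalize c v = w at *
      obtain ⟨x, y⟩ := z
      simp only [latticePoint] at *
      rcases huv with rfl | ⟨⟨j, rfl⟩, rfl⟩
      · have hax : a = x := h3.antisymm h1
        by_cases hy : 0 ≤ y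
        · refine Or.inl ⟨x, hax, g1, g2, ?_, ?_⟩
          · exact le_trans (by exact_mod_cast hy) h2
          · exact h4.trans (by exact_mod_cast g3')
        · have hy' : x = 0 ∧ -r ≤ y := by omega
          refine Or.inr (Or.inr ⟨by simp [hax, hy'.1], ?_, ?_⟩)
          · exact le_trans (by exact_mod_cast hy'.2) h2
          · exact h4.trans (by exact_mod_cast (show y + 1 ≤ 0 by omega))
      · have hbj : b = q * j := by
          have := h4.antisymm h2
          push_cast at this
          exact this
        have hy : 0 ≤ q * j := by omega
        refine Or.inr (Or.inl ⟨j, hbj, nonneg_of_mul_nonneg_right hy hq,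
          le_of_mul_le_mul_left g3 hq, ?_, ?_⟩)
        · exact le_trans (by exact_mod_cast g1) h1
        · exact h3.trans (by exact_mod_cast g2')
  · rintro (⟨x, hx, h1, h2, h3, h4⟩ | ⟨j, hj, h1, h2, h3, h4⟩ | ⟨hx, h1, h2⟩)
    · simp only at hx h3 h4
      subst hx
      exact hvert (s := 0) (t := q * k) (by simpa using h3) (by exact_mod_cast h4)
        fun y hy hy' => ⟨h1, h2, hy', Or.inl hy⟩
    · simp only at hj h3 h4
      have hj0 : 0 ≤ q * j := mul_nonneg hq.le h1
      have hjk : q * j ≤ q * k := mul_le_mul_of_nonneg_left h2 hq.le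
      have hb : b = ((q * j : ℤ) : ℝ) := by rw [hj]; push_cast; rfl
      subst hb
      have hs' : 0 ≤ ⌊a⌋ := Int.le_floor.2 (by simpa using h3)
      rcases hfloor (a := q * k) (b := a) (by exact_mod_cast h4) with rfl | ht'
      · exact hpoint (z := (q * k, q * j)) ⟨hH.le, le_rfl, hjk, Or.inl hj0⟩
      · refine hstep (z := (⌊a⌋, q * j)) (w := (⌊a⌋ + 1, q * j))
          ⟨hs', by simp only; omega, hjk, Or.inl hj0⟩
          ⟨by simp only; omega, ht', hjk, Or.inl hj0⟩ (Or.inr ⟨dvd_mul_right _ _, rfl⟩) ⟨?_, ?_⟩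
        · exact ⟨Int.floor_le a, le_rfl⟩
        · refine ⟨?_, le_rfl⟩
          simpa [latticePoint] using (Int.lt_floor_add_one a).le
    · simp only at hx h1 h2
      subst hx
      have := hvert (x := 0) (s := -r) (t := 0) (b := b) (by exact_mod_cast h1)
        (by exact_mod_cast h2) fun y hy hy' => ⟨le_rfl, hH.le, by simp only; omega,
          Or.inr ⟨rfl, hy⟩⟩
      simpa using this

/-- An open cell of the drawing of a square grid. -/
def gridCell (q x j : ℤ) : Set (ℝ × ℝ) :=
  Set.Ioo (x : ℝ) (x + 1) ×ˢ Set.Ioo (q * j : ℝ) (q * (j + 1))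

theorem closure_gridCell {q x j : ℤ} (hq : 0 < q) :
    closure (gridCell q x j) = Set.Icc (x : ℝ) (x + 1) ×ˢ Set.Icc (q * j : ℝ) (q * (j + 1)) := by
  have : (0 : ℝ) < q := by exact_mod_cast hq
  rw [gridCell, closure_prod_eq, closure_Ioo (by linarith), closure_Ioo (by nlinarith)]

theorem gridCell_subset_compl {q k r x j : ℤ} (hq : 0 < q) (hx : 0 ≤ x) :
    gridCell q x j ⊆ (gridDrawing q k r)ᶜ := by
  have hq' : (0 : ℝ) < q := by exact_mod_cast hq
  rintro ⟨a, b⟩ ⟨⟨h1, h2⟩, h3, h4⟩ (⟨y, hy, -⟩ | ⟨i, hi, -⟩ | ⟨h, -⟩) <;> simp only at *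
  · subst hy
    have h1 : x < y := by exact_mod_cast h1
    have h2 : y < x + 1 := by exact_mod_cast h2
    omega
  · subst hi
    have h1 : j < i := by exact_mod_cast lt_of_mul_lt_mul_left h3 hq'.le
    have h2 : i < j + 1 := by exact_mod_cast lt_of_mul_lt_mul_left h4 hq'.le
    omega
  · have : (0 : ℝ) ≤ x := by exact_mod_cast hx
    linarith

theorem closure_gridCell_inter_compl_subset {q k r x j : ℤ} (hq : 0 < q) (hx : 0 ≤ x)
    (hxH : x + 1 ≤ q * k) (hj : 0 ≤ j) (hjk : j + 1 ≤ k) :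
    closure (gridCell q x j) ∩ (gridDrawing q k r)ᶜ ⊆ gridCell q x j := by
  rw [closure_gridCell hq]
  have hq' : (0 : ℝ) < q := by exact_mod_cast hq
  have hx' : (0 : ℝ) ≤ x := by exact_mod_cast hx
  have hxH' : (x : ℝ) + 1 ≤ q * k := by exact_mod_cast hxH
  have hj' : (0 : ℝ) ≤ q * j := mul_nonneg hq'.le (by exact_mod_cast hj)
  have hjk' : (q : ℝ) * (j + 1) ≤ q * k :=
    mul_le_mul_of_nonneg_left (by exact_mod_cast hjk) hq'.le
  rintro ⟨a, b⟩ ⟨⟨⟨h1, h2⟩, h3, h4⟩, hP⟩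
  simp only at h1 h2 h3 h4
  refine ⟨⟨lt_of_le_of_ne h1 ?_, lt_of_le_of_ne h2 ?_⟩, lt_of_le_of_ne h3 ?_, lt_of_le_of_ne h4 ?_⟩
  · intro h
    exact hP (Or.inl ⟨x, h.symm, hx, by omega, by simp only; linarith, by simp only; linarith⟩)
  · intro h
    exact hP (Or.inl ⟨x + 1, by simpa using h, by omega, hxH, by simp only; linarith,
      by simp only; linarith⟩)
  · intro h
    exact hP (Or.inr (Or.inl ⟨j, h.symm, hj, by omega, by simp only; linarith,
      by simp only; linarith⟩))
  · intro h
    exact hP (Or.inr (Or.inl ⟨j + 1, by simpa using h, by omega, hjk, by simp only; linarith,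
      by simp only; linarith⟩))

theorem connectedComponentIn_compl_gridDrawing {q k r x j : ℤ} (hq : 0 < q) (hx : 0 ≤ x)
    (hxH : x + 1 ≤ q * k) (hj : 0 ≤ j) (hjk : j + 1 ≤ k) {P : ℝ × ℝ} (hP : P ∈ gridCell q x j) :
    connectedComponentIn (gridDrawing q k r)ᶜ P = gridCell q x j := by
  have hsub := gridCell_subset_compl (k := k) (r := r) (j := j) hq hx
  refine Set.Subset.antisymm ?_ ?_
  · refine isPreconnected_connectedComponentIn.subset_of_closure_inter_subset
      (isOpen_Ioo.prod isOpen_Ioo) ⟨P, mem_connectedComponentIn (hsub hP), hP⟩ ?_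
    exact (Set.inter_subset_inter_right _ (connectedComponentIn_subset _ _)).trans
      (closure_gridCell_inter_compl_subset hq hx hxH hj hjk)
  · exact (isPreconnected_Ioo.prod isPreconnected_Ioo).subset_connectedComponentIn hP hsub

theorem not_isBounded_connectedComponentIn {S R : Set (ℝ × ℝ)} {P : ℝ × ℝ}
    (hR : IsPreconnected R) (hP : P ∈ R) (hRS : R ⊆ S) (hb : ¬ IsBounded R) :
    ¬ IsBounded (connectedComponentIn S P) := fun h =>
  hb (h.subset (hR.subset_connectedComponentIn hP hRS))

theorem isBounded_connectedComponentIn_gridDrawing {q k r : ℤ} (hq : 0 < q) (hk : 0 < k)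
    (hr : 0 ≤ r) {P : ℝ × ℝ} (hP : P ∉ gridDrawing q k r)
    (hb : IsBounded (connectedComponentIn (gridDrawing q k r)ᶜ P)) :
    ∃ x j : ℤ, 0 ≤ x ∧ x + 1 ≤ q * k ∧ 0 ≤ j ∧ j + 1 ≤ k ∧ P ∈ gridCell q x j := by
  obtain ⟨a, b⟩ := P
  have hq' : (0 : ℝ) < q := by exact_mod_cast hq
  have hk' : (0 : ℝ) < k := by exact_mod_cast hk
  have hr' : (0 : ℝ) ≤ r := by exact_mod_cast hr
  have hH : (0 : ℝ) < q * k := mul_pos hq' hk'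
  have hline : ∀ P ∈ gridDrawing q k r, (0 ≤ P.1 ∧ P.1 ≤ q * k ∧ 0 ≤ P.2 ∧ P.2 ≤ q * k) ∨
      (P.1 = 0 ∧ -r ≤ P.2 ∧ P.2 ≤ 0) := by
    rintro P (⟨x, hx, h1, h2, h3⟩ | ⟨j, hj, h1, h2, h3⟩ | h)
    · exact Or.inl ⟨by rw [hx]; exact_mod_cast h1, by rw [hx]; exact_mod_cast h2, h3⟩
    · refine Or.inl ⟨h3.1, h3.2, ?_, ?_⟩ <;> rw [hj]
      · exact mul_nonneg hq'.le (by exact_mod_cast h1)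
      · exact mul_le_mul_of_nonneg_left (by exact_mod_cast h2) hq'.le
    · exact Or.inr h
  have hray : ∀ {s t : Set ℝ}, s.OrdConnected → t.OrdConnected → a ∈ s → b ∈ t →
      (¬ IsBounded s ∨ ¬ IsBounded t) →
      (∀ P ∈ s ×ˢ t, (0 ≤ P.1 ∧ P.1 ≤ q * k ∧ 0 ≤ P.2 ∧ P.2 ≤ q * k) ∨
        (P.1 = 0 ∧ -r ≤ P.2 ∧ P.2 ≤ 0) → False) → False := by
    intro s t hs ht has hbt hst h
    refine not_isBounded_connectedComponentIn (hs.isPreconnected.prod ht.isPreconnected)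
      ⟨has, hbt⟩ (fun P hP' hPd => h P hP' (hline P hPd)) ?_ hb
    rw [Bornology.isBounded_prod_of_nonempty ⟨(a, b), has, hbt⟩]
    tauto
  have hIic : ∀ a : ℝ, ¬ IsBounded (Set.Iic a) := fun a h => not_bddBelow_Iic a h.bddBelow
  have hIci : ∀ a : ℝ, ¬ IsBounded (Set.Ici a) := fun a h => not_bddAbove_Ici a h.bddAbove
  have hleft : 0 ≤ a := by
    by_contra! h
    refine hray (s := Set.Iic a) (t := {b}) Set.ordConnected_Iic Set.ordConnected_singleton
      (Set.mem_Iic.2 le_rfl) rfl (Or.inl (hIic a)) ?_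
    rintro ⟨x, y⟩ ⟨hx, -⟩
    have hx : x ≤ a := hx
    rintro (g | g) <;> simp only at g <;> linarith
  have hbot : 0 ≤ b := by
    by_contra! h
    rcases hleft.eq_or_lt with h0 | h0
    · have hbr : b < -r := by
        by_contra! hbr
        exact hP (Or.inr (Or.inr ⟨h0.symm, hbr, h.le⟩))
      refine hray (s := {a}) (t := Set.Iic b) Set.ordConnected_singleton Set.ordConnected_Iic
        rfl (Set.mem_Iic.2 le_rfl) (Or.inr (hIic b)) ?_
      rintro ⟨x, y⟩ ⟨-, hy⟩
      have hy : y ≤ b := hy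
      rintro (g | g) <;> simp only at g <;> linarith
    · refine hray (s := Set.Ici a) (t := {b}) Set.ordConnected_Ici Set.ordConnected_singleton
        (Set.mem_Ici.2 le_rfl) rfl (Or.inl (hIci a)) ?_
      rintro ⟨x, y⟩ ⟨hx, rfl⟩
      have hx : a ≤ x := hx
      rintro (g | g) <;> simp only at g <;> linarith
  have hright : a ≤ q * k := by
    by_contra! h
    refine hray (s := Set.Ici a) (t := {b}) Set.ordConnected_Ici Set.ordConnected_singleton
      (Set.mem_Ici.2 le_rfl) rfl (Or.inl (hIci a)) ?_
    rintro ⟨x, y⟩ ⟨hx, -⟩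
    have hx : a ≤ x := hx
    rintro (g | g) <;> simp only at g <;> linarith
  have htop : b ≤ q * k := by
    by_contra! h
    refine hray (s := {a}) (t := Set.Ici b) Set.ordConnected_singleton Set.ordConnected_Ici
      rfl (Set.mem_Ici.2 le_rfl) (Or.inr (hIci b)) ?_
    rintro ⟨x, y⟩ ⟨-, hy⟩
    have hy : b ≤ y := hy
    rintro (g | g) <;> simp only at g <;> linarith
  have hx0 : 0 ≤ ⌊a⌋ := Int.floor_nonneg.2 hleft
  have hj0 : 0 ≤ ⌊b / q⌋ := Int.floor_nonneg.2 (by positivity)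
  have hx1 : (⌊a⌋ : ℝ) < a := by
    refine lt_of_le_of_ne (Int.floor_le a) fun h => hP (Or.inl ⟨_, h.symm, hx0, ?_, hbot, htop⟩)
    exact_mod_cast h.trans_le hright
  have hbq : (q : ℝ) * (b / q) = b := mul_div_cancel₀ b hq'.ne'
  have hj1 : (⌊b / q⌋ : ℝ) < b / q := by
    refine lt_of_le_of_ne (Int.floor_le _) fun h =>
      hP (Or.inr (Or.inl ⟨_, by simp only; rw [h, hbq], hj0, ?_, hleft, hright⟩))
    have : b / q ≤ k := (div_le_iff₀' hq').2 htop
    exact_mod_cast h.trans_le this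
  have hx2 : ⌊a⌋ < q * k := by exact_mod_cast hx1.trans_le hright
  have hj2 : ⌊b / q⌋ < k := by exact_mod_cast hj1.trans_le ((div_le_iff₀' hq').2 htop)
  refine ⟨⌊a⌋, ⌊b / q⌋, hx0, hx2, hj0, hj2, ⟨hx1, Int.lt_floor_add_one a⟩, ?_, ?_⟩
  · exact (mul_lt_mul_of_pos_left hj1 hq').trans_eq hbq
  · exact hbq.symm.trans_lt (mul_lt_mul_of_pos_left (Int.lt_floor_add_one _) hq')

theorem isBoundedFace_gridEmbedding_iff {V : Type} {q k r : ℤ} (hq : 0 < q) (hk : 0 < k)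
    (hr : 0 ≤ r) {c : V → ℤ × ℤ} (hc : Function.Injective c)
    (hrange : ∀ z, (∃ v, c v = z) ↔ z ∈ gridRegion (q * k) r) (f : Set (ℝ × ℝ)) :
    (gridEmbedding q c hc).IsBoundedFace f ↔
      ∃ x j : ℤ, 0 ≤ x ∧ x + 1 ≤ q * k ∧ 0 ≤ j ∧ j + 1 ≤ k ∧ f = gridCell q x j := by
  rw [PlaneEmbedding.IsBoundedFace, PlaneEmbedding.IsFace, image_gridEmbedding hq hk hr hc hrange]
  constructor
  · rintro ⟨⟨P, hP, rfl⟩, hb⟩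
    obtain ⟨x, j, h1, h2, h3, h4, h5⟩ :=
      isBounded_connectedComponentIn_gridDrawing hq hk hr hP hb
    exact ⟨x, j, h1, h2, h3, h4, connectedComponentIn_compl_gridDrawing hq h1 h2 h3 h4 h5⟩
  · rintro ⟨x, j, h1, h2, h3, h4, rfl⟩
    have hq' : (0 : ℝ) < q := by exact_mod_cast hq
    have hP : ((x : ℝ) + 1 / 2, (q : ℝ) * (j + 1 / 2)) ∈ gridCell q x j :=
      ⟨⟨by simp only; linarith, by simp only; linarith⟩,
        by simp only; nlinarith, by simp only; nlinarith⟩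
    exact ⟨⟨_, gridCell_subset_compl hq h1 hP,
      (connectedComponentIn_compl_gridDrawing hq h1 h2 h3 h4 hP).symm⟩,
      (Metric.isBounded_Ioo _ _).prod (Metric.isBounded_Ioo _ _)⟩

theorem mem_boundaryVerts_gridCell {V : Type} {q x j : ℤ} (hq : 0 < q) {c : V → ℤ × ℤ}
    (hc : Function.Injective c) (v : V) :
    v ∈ (gridEmbedding q c hc).boundaryVerts (gridCell q x j) ↔
      c v ∈ Set.Icc x (x + 1) ×ˢ Set.Icc (q * j) (q * (j + 1)) := by
  change latticePoint (c v) ∈ closure (gridCell q x j) ↔ _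
  rw [closure_gridCell hq]
  simp only [latticePoint, Set.mem_prod, Set.mem_Icc]
  norm_cast

theorem ncard_boundaryVerts_gridCell_le {V : Type} {q : ℕ} {x j : ℤ} (hq : 0 < q)
    {c : V → ℤ × ℤ} (hc : Function.Injective c) :
    ((gridEmbedding q c hc).boundaryVerts (gridCell q x j)).ncard ≤ 2 * (q + 1) := by
  have hle := Set.ncard_le_ncard_of_injOn
    (s := (gridEmbedding q c hc).boundaryVerts (gridCell q x j))
    (t := ↑(Finset.Icc x (x + 1) ×ˢ Finset.Icc ((q : ℤ) * j) (q * (j + 1)))) c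
    (fun v hv => by
      have := (mem_boundaryVerts_gridCell (by exact_mod_cast hq) hc v).1 hv
      simpa using this) hc.injOn (Finset.finite_toSet _)
  refine hle.trans_eq ?_
  rw [Set.ncard_coe_finset, Finset.card_product, Int.card_Icc, Int.card_Icc, mul_add]
  congr 1 <;> omega

/-- An embedded tree decomposition of the grid with subdivided columns is a tree decomposition of
the full grid. -/
theorem IsEmDecomp.isTreeDecomp_gridGraph_one {V : Type} {q k r : ℤ} (hq : 0 < q) (hk : 0 < k)
    (hr : 0 ≤ r) {c : V → ℤ × ℤ} {hc : Function.Injective c}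
    (hrange : ∀ z, (∃ v, c v = z) ↔ z ∈ gridRegion (q * k) r) {D : Decomp V}
    (hD : IsEmDecomp (gridEmbedding q c hc) D) : IsTreeDecomp (gridGraph 1 c) D := by
  refine ⟨hD.1.1, ?_, hD.1.2.2⟩
  have key : ∀ u v, GridStep 1 (c u) (c v) → ∃ i, u ∈ D.bag i ∧ v ∈ D.bag i := by
    intro u v huv
    by_cases h : GridStep q (c u) (c v)
    · exact hD.1.2.1 u v h.adj
    have hu := (hrange _).1 ⟨u, rfl⟩
    have hv := (hrange _).1 ⟨v, rfl⟩
    have hmem := fun x j => mem_boundaryVerts_gridCell (q := q) (x := x) (j := j) hq hc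
    generalize hcu : c u = z at *
    generalize hcv : c v = w at *
    obtain ⟨x, y⟩ := z
    rcases huv with rfl | ⟨-, rfl⟩
    · exact absurd (Or.inl rfl) h
    have hqy : ¬ q ∣ y := fun hqy => h (Or.inr ⟨hqy, rfl⟩)
    simp only [gridRegion, Set.mem_ofPred_eq] at hu hv
    have hy : 0 ≤ y := by omega
    have h1 := Int.mul_ediv_self_le (x := y) hq.ne'
    have h2 : y < q * (y / q + 1) := by
      have := Int.lt_mul_ediv_self_add (x := y) hq
      rwa [mul_add, mul_one]
    have h3 : y / q < k := by
      refine Int.ediv_lt_of_lt_mul hq (lt_of_le_of_ne (by rw [mul_comm]; exact hu.2.2.1) ?_)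
      rintro rfl
      exact hqy (dvd_mul_left _ _)
    obtain ⟨i, hi⟩ := hD.2 (gridCell q x (y / q))
      ((isBoundedFace_gridEmbedding_iff hq hk hr hc hrange _).2
        ⟨x, y / q, hu.1, hv.2.1, Int.ediv_nonneg hy hq.le, h3, rfl⟩)
    refine ⟨i, hi ((hmem _ _ u).2 ?_), hi ((hmem _ _ v).2 ?_)⟩
    · rw [hcu]
      exact ⟨⟨le_rfl, by simp⟩, h1, h2.le⟩
    · rw [hcv]
      exact ⟨⟨by simp, le_rfl⟩, h1, h2.le⟩
  intro u v huv
  rcases ((SimpleGraph.fromRel_adj _ _ _).1 huv).2 with h | h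
  · exact key u v h
  · obtain ⟨i, hi⟩ := key v u h
    exact ⟨i, hi.symm⟩

/-- A bijection from `Fin n` onto the lattice points of a square of side `H` with a tail. -/
theorem exists_gridCoordinates (H r : ℕ) :
    ∃ c : Fin ((H + 1) * (H + 1) + r) → ℤ × ℤ, Function.Injective c ∧
      ∀ z, (∃ v, c v = z) ↔ z ∈ gridRegion H r := by
  let S : Finset (ℤ × ℤ) :=
    (Finset.Icc 0 (H : ℤ) ×ˢ Finset.Icc 0 (H : ℤ)).disjUnion ({0} ×ˢ Finset.Ico (-(r : ℤ)) 0) (by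
      rw [Finset.disjoint_left]
      intro z hz hz'
      simp only [Finset.mem_product, Finset.mem_Icc, Finset.mem_Ico] at hz hz'
      omega)
  have hcard : S.card = (H + 1) * (H + 1) + r := by
    simp only [S, Finset.card_disjUnion, Finset.card_product, Int.card_Icc, Int.card_Ico,
      Finset.card_singleton]
    congr 1
    · omega
  have hS : ∀ z, z ∈ S ↔ z ∈ gridRegion H r := by
    rintro ⟨x, y⟩
    simp only [S, Finset.mem_disjUnion, Finset.mem_product, Finset.mem_Icc, Finset.mem_Ico,
      Finset.mem_singleton, gridRegion, Set.mem_ofPred_eq]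
    omega
  let e := S.equivFinOfCardEq hcard
  refine ⟨fun v => (e.symm v : ℤ × ℤ), Subtype.val_injective.comp e.symm.injective, fun z => ?_⟩
  rw [← hS]
  constructor
  · rintro ⟨v, rfl⟩
    exact (e.symm v).2
  · intro hz
    exact ⟨e ⟨z, hz⟩, by simp⟩

/-- For every `t ≥ 2` and even `l ≥ 4`, for all sufficiently large `n`
there is a plane graph on `n` vertices of treewidth exactly `t`, all of whose bounded
faces have length at most `l`, with em-width at least `(l/2 − 1)(t − 1)`. -/
theorem emwidth_lowerBound_treewidth (t : ℕ) (ht : 2 ≤ t) (l : ℕ) (hl : 4 ≤ l)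
    (hleven : Even l) :
    ∃ N : ℕ, ∀ n : ℕ, N ≤ n →
      ∃ (G : SimpleGraph (Fin n)) (P : PlaneEmbedding G),
        treewidth G = t ∧
        (∀ f, P.IsBoundedFace f → (P.boundaryVerts f).ncard ≤ l) ∧
        (l / 2 - 1) * (t - 1) ≤ emwidth P := by
  obtain ⟨m, rfl⟩ := hleven
  obtain ⟨q, rfl⟩ : ∃ q, m = q + 1 := ⟨m - 1, by omega⟩
  obtain ⟨k, rfl⟩ : ∃ k, t = k + 1 := ⟨t - 1, by omega⟩
  have hq : 0 < q := by omega
  have hk : 0 < k := by omega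
  have hq' : (0 : ℤ) < q := by exact_mod_cast hq
  have hk' : (0 : ℤ) < k := by exact_mod_cast hk
  refine ⟨(q * k + 1) * (q * k + 1), fun n hn => ?_⟩
  obtain ⟨r, rfl⟩ := Nat.exists_eq_add_of_le hn
  obtain ⟨c, hc, hrange⟩ := exists_gridCoordinates (q * k) r
  have hrange' : ∀ z, (∃ v, c v = z) ↔ z ∈ gridRegion ((q : ℤ) * k) r := by
    simpa only [Nat.cast_mul] using hrange
  have hr : (0 : ℤ) ≤ r := Nat.cast_nonneg r
  refine ⟨gridGraph q c, gridEmbedding q c hc, le_antisymm ?_ ?_, ?_, ?_⟩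
  · exact treewidth_gridGraph_le hc (fun v => (hrange' _).1 ⟨v, rfl⟩) hq' hk
  · exact le_treewidth fun D hD =>
      exists_large_bag_gridGraph (fun z hz => (hrange z).2 hz) hq hk rfl hD
  · intro f hf
    obtain ⟨x, j, -, -, -, -, rfl⟩ :=
      (isBoundedFace_gridEmbedding_iff hq' hk' hr hc hrange' f).1 hf
    exact (ncard_boundaryVerts_gridCell_le hq hc).trans_eq (by ring)
  · have hql : (q + 1 + (q + 1)) / 2 - 1 = q := by omega
    rw [hql, Nat.add_sub_cancel]
    refine le_emwidth fun D hD => ?_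
    obtain ⟨i, hi⟩ := exists_large_bag_gridGraph (p := 1) (k := q * k)
      (fun z hz => (hrange z).2 hz) one_pos (Nat.mul_pos hq hk) (one_mul _).symm
      (by simpa using hD.isTreeDecomp_gridGraph_one hq' hk' hr hrange')
    exact ⟨i, by omega⟩
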